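/- (The generalized Steiner line) Let A, B, C, D, E, F be six distinct points of ℙ²(ℂ) on an irreducible conic, no three collinear, and let 𝒟 be a cubic through all six points. Define the lines p₁, p₂, p₃, p₄ as the generalized Pascal lines of 𝒟 with the reducible cubics l(AB)·l(DF)·l(CE), l(AD)·l(BC)·l(EF), l(AE)·l(BD)·l(CF), l(AC)·l(BF)·l(DE) respectively, and q₁, q₂, q₃, q₄ as the generalized Pascal lines of 𝒟 with l(AC)·l(EF)·l(BD), l(AB)·l(CF)·l(DE), l(AD)·l(BF)·l(CE), l(AE)·l(BC)·l(DF) respectively, assuming each of these eight pairs of cubics satisfies the hypotheses for a generalized Pascal line and that pᵢ ≠ qᵢ for each i = 1, 2, 3, 4. Then the four generalized Steiner points p₁ ∩ q₁, p₂ ∩ q₂, p₃ ∩ q₃ and p₄ ∩ q₄ are collinear. -/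

import Mathlib

open MvPolynomial

noncomputable section

/-- Polynomials in three variables over `ℂ`. -/
abbrev Poly3 : Type := MvPolynomial (Fin 3) ℂ

/-- The complex projective plane `ℙ²(ℂ)`, the projectivization of `ℂ³`. -/
abbrev ProjPlane : Type := Projectivization ℂ (Fin 3 → ℂ)

/-- A (homogeneous) polynomial vanishes at a projective point if it vanishes at its
canonical nonzero representative vector (for homogeneous polynomials this is equivalent
to vanishing at any nonzero representative vector). -/
def VanishesAt (F : Poly3) (p : ProjPlane) : Prop :=
  MvPolynomial.eval p.rep F = 0

/-- The set of points of `ℙ²(ℂ)` at which `F` vanishes. -/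
def zeroSet (F : Poly3) : Set ProjPlane := {p | VanishesAt F p}

/-- Two defining polynomials give the same curve iff they are proportional by a
nonzero scalar. -/
def ProportionalTo (F G : Poly3) : Prop := ∃ c : ℂ, c ≠ 0 ∧ G = c • F

/-- A set of points is collinear if some nonzero homogeneous polynomial of degree 1
vanishes at all of them. -/
def Collin (s : Set ProjPlane) : Prop :=
  ∃ L : Poly3, L ≠ 0 ∧ L.IsHomogeneous 1 ∧ ∀ p ∈ s, VanishesAt L p

/-- No three distinct points of `s` are collinear. -/
def NoThreeCollinear (s : Set ProjPlane) : Prop :=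
  ∀ p q r, p ∈ s → q ∈ s → r ∈ s → p ≠ q → p ≠ r → q ≠ r → ¬ Collin {p, q, r}

/-- `L` is a (the) line through the points `p` and `q`. -/
def IsLineThrough (L : Poly3) (p q : ProjPlane) : Prop :=
  L ≠ 0 ∧ L.IsHomogeneous 1 ∧ VanishesAt L p ∧ VanishesAt L q

/-- `L` is the generalized Pascal line of the cubics `D₁` and `D₂` with respect to six
points `A, …, F`: the cubics have no common nonconstant factor, their common zero set
consists of exactly nine distinct points (the six given ones plus three further points),
and `L` is the line through the three further intersection points. -/
def IsGenPascalLine (A B C D E F : ProjPlane) (D₁ D₂ L : Poly3) : Prop :=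
  IsRelPrime D₁ D₂ ∧ L ≠ 0 ∧ L.IsHomogeneous 1 ∧
    ∃ P Q R : ProjPlane,
      ([A, B, C, D, E, F, P, Q, R] : List ProjPlane).Pairwise (· ≠ ·) ∧
      zeroSet D₁ ∩ zeroSet D₂ = {A, B, C, D, E, F, P, Q, R} ∧
      VanishesAt L P ∧ VanishesAt L Q ∧ VanishesAt L R

open Matrix

/-- The linear form with coefficient vector `w`. -/
def linForm (w : Fin 3 → ℂ) : Poly3 := ∑ i, w i • X i

lemma eval_linForm (w v : Fin 3 → ℂ) : eval v (linForm w) = w ⬝ᵥ v := by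
  simp [linForm, dotProduct, smul_eval]

lemma isHomogeneous_linForm (w : Fin 3 → ℂ) : (linForm w).IsHomogeneous 1 :=
  (homogeneousSubmodule (Fin 3) ℂ 1).sum_mem fun i _ =>
    (homogeneousSubmodule (Fin 3) ℂ 1).smul_mem _ (isHomogeneous_X ℂ i)

lemma exists_eq_linForm {L : Poly3} (hL : L.IsHomogeneous 1) : ∃ w, L = linForm w := by
  rw [← mem_homogeneousSubmodule, homogeneousSubmodule_one_eq_span_X,
    Submodule.mem_span_range_iff_exists_fun] at hL
  obtain ⟨w, hw⟩ := hL
  exact ⟨w, hw.symm⟩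

lemma coeff_linForm (w : Fin 3 → ℂ) (i : Fin 3) :
    coeff (Finsupp.single i 1) (linForm w) = w i := by
  simp [linForm, coeff_sum, coeff_X, Finsupp.single_left_inj]

lemma linForm_eq_zero {w : Fin 3 → ℂ} : linForm w = 0 ↔ w = 0 := by
  refine ⟨fun h => funext fun i => ?_, fun h => by simp [linForm, h]⟩
  rw [← coeff_linForm w, h, coeff_zero, Pi.zero_apply]

lemma irreducible_linForm {w : Fin 3 → ℂ} (hw : w ≠ 0) : Irreducible (linForm w) := by
  have h0 : linForm w ≠ 0 := linForm_eq_zero.not.2 hw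
  refine irreducible_of_totalDegree_eq_one ((isHomogeneous_linForm w).totalDegree h0)
    fun x hx => ?_
  obtain ⟨i, hi⟩ := Function.ne_iff.1 hw
  have := hx (Finsupp.single i 1)
  rw [coeff_linForm] at this
  exact isUnit_of_dvd_unit this (isUnit_iff_ne_zero.2 hi)

lemma linForm_dvd {w : Fin 3 → ℂ} (hw : w ≠ 0) {F : Poly3}
    (hF : ∀ v, w ⬝ᵥ v = 0 → eval v F = 0) : linForm w ∣ F := by
  have hp : (Ideal.span {linForm w}).IsPrime :=
    (Ideal.span_singleton_prime (linForm_eq_zero.not.2 hw)).2 (irreducible_linForm hw).prime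
  rw [← Ideal.mem_span_singleton, ← IsPrime.vanishingIdeal_zeroLocus (K := ℂ)
    (Ideal.span {linForm w})]
  intro v hv
  have := hv _ (Ideal.mem_span_singleton_self _)
  rw [aeval_eq_eval, eval_linForm] at this
  simpa [aeval_eq_eval] using hF v this

/-- The linear form through two points given by the determinant with their representatives. -/
def chord (p q : ProjPlane) : Poly3 := linForm (p.rep ⨯₃ q.rep)

lemma cross_rep_ne_zero {p q : ProjPlane} (h : p ≠ q) : p.rep ⨯₃ q.rep ≠ 0 := by
  rw [crossProduct_ne_zero_iff_linearIndependent]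
  have := (Projectivization.independent_pair_iff_ne p q).2 h
  rw [Projectivization.independent_iff] at this
  have h2 : ![p.rep, q.rep] = Projectivization.rep ∘ ![p, q] := by
    ext i
    fin_cases i <;> rfl
  rwa [h2]

lemma chord_ne_zero {p q : ProjPlane} (h : p ≠ q) : chord p q ≠ 0 :=
  linForm_eq_zero.not.2 (cross_rep_ne_zero h)

lemma isHomogeneous_chord (p q : ProjPlane) : (chord p q).IsHomogeneous 1 :=
  isHomogeneous_linForm _

lemma chord_left (p q : ProjPlane) : VanishesAt (chord p q) p := by
  rw [VanishesAt, chord, eval_linForm, dotProduct_comm, dot_self_cross]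

lemma chord_right (p q : ProjPlane) : VanishesAt (chord p q) q := by
  rw [VanishesAt, chord, eval_linForm, dotProduct_comm, dot_cross_self]

lemma eq_smul_cross {a b w : Fin 3 → ℂ} (h : a ⨯₃ b ≠ 0) (ha : w ⬝ᵥ a = 0) (hb : w ⬝ᵥ b = 0) :
    ∃ c : ℂ, w = c • (a ⨯₃ b) := by
  have h0 : w ⨯₃ (a ⨯₃ b) = 0 := by
    simp only [vec3_dotProduct] at ha hb
    simp only [cross_apply]
    ext i
    fin_cases i <;> simp
    · linear_combination a 0 * hb - b 0 * ha
    · linear_combination a 1 * hb - b 1 * ha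
    · linear_combination a 2 * hb - b 2 * ha
  have h1 : ¬ LinearIndependent ℂ ![a ⨯₃ b, w] := by
    rw [← crossProduct_ne_zero_iff_linearIndependent, not_not, ← cross_anticomm, h0, neg_zero]
  rw [LinearIndependent.pair_iff' h] at h1
  push Not at h1
  exact h1.imp fun _ hc => hc.symm

lemma exists_eq_smul_chord {L : Poly3} {p q : ProjPlane} (h : p ≠ q)
    (hL : L.IsHomogeneous 1) (hp : VanishesAt L p) (hq : VanishesAt L q) :
    ∃ c : ℂ, L = c • chord p q := by
  obtain ⟨w, rfl⟩ := exists_eq_linForm hL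
  rw [VanishesAt, eval_linForm] at hp hq
  obtain ⟨c, rfl⟩ := eq_smul_cross (cross_rep_ne_zero h) hp hq
  exact ⟨c, by simp [linForm, chord, Finset.smul_sum, mul_smul]⟩

lemma exists_eq_add_of_cross_dot {a b v : Fin 3 → ℂ} (h : a ⨯₃ b ≠ 0)
    (hv : (a ⨯₃ b) ⬝ᵥ v = 0) : ∃ s t : ℂ, v = s • a + t • b := by
  obtain ⟨s, hs⟩ := eq_smul_cross (w := v ⨯₃ b) h
    (by rw [← neg_zero, ← hv]; simp [dotProduct, Fin.sum_univ_three, cross_apply]; ring)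
    (by rw [dotProduct_comm, dot_cross_self])
  obtain ⟨t, ht⟩ := eq_smul_cross (w := a ⨯₃ v) h
    (by rw [dotProduct_comm, dot_self_cross])
    (by rw [← neg_zero, ← hv]; simp [dotProduct, Fin.sum_univ_three, cross_apply]; ring)
  refine ⟨s, t, ?_⟩
  obtain ⟨i, hi⟩ := Function.ne_iff.1 h
  simp [cross_apply, _root_.funext_iff, Fin.forall_fin_succ, dotProduct,
    Fin.sum_univ_three] at hs ht hv
  rw [cross_apply] at hi
  obtain ⟨s0, s1, s2⟩ := hs
  obtain ⟨t0, t1, t2⟩ := ht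
  ext j
  refine mul_left_cancel₀ hi ?_
  fin_cases i <;> fin_cases j <;> simp [-mul_eq_mul_left_iff]
  · linear_combination hv + a 0 * s0 + b 0 * t0
  · linear_combination a 1 * s0 + b 1 * t0
  · linear_combination a 2 * s0 + b 2 * t0
  · linear_combination a 0 * s1 + b 0 * t1
  · linear_combination hv + a 1 * s1 + b 1 * t1
  · linear_combination a 2 * s1 + b 2 * t1
  · linear_combination a 0 * s2 + b 0 * t2
  · linear_combination a 1 * s2 + b 1 * t2
  · linear_combination hv + a 2 * s2 + b 2 * t2

lemma exists_polar {K : Poly3} (hK : K.IsHomogeneous 2) (a b : Fin 3 → ℂ) :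
    ∃ β : ℂ, ∀ s t : ℂ, eval (s • a + t • b) K = s ^ 2 * eval a K + s * t * β + t ^ 2 * eval b K := by
  rw [← mem_homogeneousSubmodule, ← homogeneousSubmodule_one_pow, pow_two] at hK
  induction hK using Submodule.mul_induction_on' with
  | mem_mul_mem m hm n hn =>
    obtain ⟨u, rfl⟩ := exists_eq_linForm hm
    obtain ⟨w, rfl⟩ := exists_eq_linForm hn
    refine ⟨(u ⬝ᵥ a) * (w ⬝ᵥ b) + (u ⬝ᵥ b) * (w ⬝ᵥ a), fun s t => ?_⟩
    simp only [eval_linForm, map_mul, dotProduct_add, dotProduct_smul, smul_eq_mul]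
    ring
  | add x _ y _ hx hy =>
    obtain ⟨β, hβ⟩ := hx
    obtain ⟨γ, hγ⟩ := hy
    refine ⟨β + γ, fun s t => ?_⟩
    simp only [map_add, hβ, hγ]
    ring

/-- A conic vanishing at three distinct points of a line contains the line. -/
lemma chord_dvd_of_three {K : Poly3} (hK : K.IsHomogeneous 2) {p q r : ProjPlane}
    (hpq : p ≠ q) (hpr : p ≠ r) (hqr : q ≠ r) (hp : VanishesAt K p) (hq : VanishesAt K q)
    (hr : VanishesAt K r) (hpqr : VanishesAt (chord p q) r) : chord p q ∣ K := by
  have h := cross_rep_ne_zero hpq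
  rw [VanishesAt, chord, eval_linForm] at hpqr
  obtain ⟨s, t, hst⟩ := exists_eq_add_of_cross_dot h hpqr
  obtain ⟨β, hβ⟩ := exists_polar hK p.rep q.rep
  have hβ0 : s * t * β = 0 := by
    have := hβ s t
    rw [VanishesAt] at hp hq hr
    rw [← hst, hp, hq, hr] at this
    linear_combination -this
  have ht : t ≠ 0 := by
    rintro rfl
    refine cross_rep_ne_zero hpr ?_
    rw [hst]
    simp
  have hs : s ≠ 0 := by
    rintro rfl
    refine cross_rep_ne_zero hqr ?_
    rw [hst]
    simp
  have hβ' : β = 0 := by simpa [hs, ht] using hβ0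
  refine linForm_dvd h fun v hv => ?_
  obtain ⟨x, y, rfl⟩ := exists_eq_add_of_cross_dot h hv
  rw [VanishesAt] at hp hq
  rw [hβ, hp, hq, hβ']
  ring

lemma finrank_cubics : Module.finrank ℂ (homogeneousSubmodule (Fin 3) ℂ 3) = 10 := by
  have hs : homogeneousSubmodule (Fin 3) ℂ 3 = restrictSupport ℂ
      ((Finset.univ : Finset (Fin 3)).finsuppAntidiag 3 : Set (Fin 3 →₀ ℕ)) := by
    rw [homogeneousSubmodule_eq_finsupp_supported]
    congr 1
    ext d
    simp [Finset.mem_finsuppAntidiag, Finsupp.degree_eq_sum]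
  rw [hs, Module.finrank_eq_card_basis (basisRestrictSupport ℂ _)]
  simp [Finset.card_finsuppAntidiag_nat_eq_choose, Nat.choose]

/-- The product of the three chords joining consecutive pairs of the six listed points. -/
def chordTriple (pt : Fin 6 → ProjPlane) (f : Fin 6 → Fin 6) : Poly3 :=
  chord (pt (f 0)) (pt (f 1)) * chord (pt (f 2)) (pt (f 3)) * chord (pt (f 4)) (pt (f 5))

lemma isHomogeneous_chordTriple (pt : Fin 6 → ProjPlane) (f : Fin 6 → Fin 6) :
    (chordTriple pt f).IsHomogeneous 3 :=
  ((isHomogeneous_chord _ _).mul (isHomogeneous_chord _ _)).mul (isHomogeneous_chord _ _)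

lemma chord_not_vanishesAt {pt : Fin 6 → ProjPlane} (hpt : Function.Injective pt)
    (hn3 : NoThreeCollinear (Set.range pt)) {i j k : Fin 6} (hij : i ≠ j) (hik : i ≠ k)
    (hjk : j ≠ k) : ¬ VanishesAt (chord (pt i) (pt j)) (pt k) := by
  intro h
  refine hn3 (pt i) (pt j) (pt k) ⟨i, rfl⟩ ⟨j, rfl⟩ ⟨k, rfl⟩ (hpt.ne hij) (hpt.ne hik)
    (hpt.ne hjk) ⟨_, chord_ne_zero (hpt.ne hij), isHomogeneous_chord _ _, ?_⟩
  rintro p (rfl | rfl | rfl)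
  exacts [chord_left _ _, chord_right _ _, h]

/-- A cubic through all but one of the six points. -/
lemma exists_separating_cubic {pt : Fin 6 → ProjPlane} (hpt : Function.Injective pt)
    (hn3 : NoThreeCollinear (Set.range pt)) (i : Fin 6) :
    ∃ T : Poly3, T.IsHomogeneous 3 ∧ ¬ VanishesAt T (pt i) ∧ ∀ j, j ≠ i → VanishesAt T (pt j) := by
  set g := Equiv.swap 0 i with hg
  have hgi : g 0 = i := Equiv.swap_apply_left 0 i
  refine ⟨chord (pt (g 1)) (pt (g 2)) * chord (pt (g 3)) (pt (g 4)) * chord (pt (g 5)) (pt (g 1)),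
    ((isHomogeneous_chord _ _).mul (isHomogeneous_chord _ _)).mul (isHomogeneous_chord _ _), ?_, ?_⟩
  · have h (a b : Fin 6) (ha : a ≠ 0) (hb : b ≠ 0) (hab : a ≠ b) :
        ¬ VanishesAt (chord (pt (g a)) (pt (g b))) (pt i) :=
      chord_not_vanishesAt hpt hn3 (g.injective.ne hab) (hgi ▸ g.injective.ne ha)
        (hgi ▸ g.injective.ne hb)
    have h1 := h 1 2 (by decide) (by decide) (by decide)
    have h2 := h 3 4 (by decide) (by decide) (by decide)
    have h3 := h 5 1 (by decide) (by decide) (by decide)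
    simp only [VanishesAt, map_mul] at h1 h2 h3 ⊢
    exact mul_ne_zero (mul_ne_zero h1 h2) h3
  · intro j hj
    obtain ⟨k, rfl⟩ := g.surjective j
    have l (a b : Fin 6) := chord_left (pt (g a)) (pt (g b))
    have r (a b : Fin 6) := chord_right (pt (g a)) (pt (g b))
    simp only [VanishesAt] at l r
    fin_cases k
    · exact absurd hgi hj
    all_goals simp [VanishesAt, l, r]

/-- Modulo a conic through six points, no three of them collinear, any two cubics through the
six points are proportional. -/
lemma exists_conic_mul_eq {pt : Fin 6 → ProjPlane} (hpt : Function.Injective pt)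
    (hn3 : NoThreeCollinear (Set.range pt)) {K D T : Poly3} (hK0 : K ≠ 0)
    (hK : K.IsHomogeneous 2)
    (honK : ∀ i, VanishesAt K (pt i)) (hKD : ¬ K ∣ D)
    (hD : D.IsHomogeneous 3) (honD : ∀ i, VanishesAt D (pt i))
    (hT : T.IsHomogeneous 3) (honT : ∀ i, VanishesAt T (pt i)) :
    ∃ τ : ℂ, ∃ w, K * linForm w = T - τ • D := by
  let N := homogeneousSubmodule (Fin 3) ℂ 3
  have hfd : FiniteDimensional ℂ N :=
    Module.Finite.iff_fg.2 (homogeneousSubmodule_fg (Fin 3) ℂ 3)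
  let ev : N →ₗ[ℂ] (Fin 6 → ℂ) :=
    LinearMap.pi fun i => (aeval (pt i).rep).toLinearMap ∘ₗ N.subtype
  have hev (F : N) (i) : ev F i = eval (pt i).rep F.1 := by
    simp [ev, aeval_eq_eval]
  have hsurj : LinearMap.range ev = ⊤ := by
    rw [LinearMap.range_eq_top]
    choose S hS hSi hSj using exists_separating_cubic hpt hn3
    intro v
    refine ⟨∑ i, (v i / eval (pt i).rep (S i)) • (⟨S i, hS i⟩ : N), ?_⟩
    ext j
    rw [map_sum, Finset.sum_apply, Finset.sum_eq_single j]
    · rw [map_smul, Pi.smul_apply, hev, smul_eq_mul]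
      exact div_mul_cancel₀ _ (hSi j)
    · intro i _ hij
      rw [map_smul, Pi.smul_apply, hev, smul_eq_mul]
      exact mul_eq_zero_of_right _ (hSj i j hij.symm)
    · simp
  have hker : Module.finrank ℂ (LinearMap.ker ev) = 4 := by
    have := ev.finrank_range_add_finrank_ker
    rw [hsurj, finrank_top, Module.finrank_fin_fun] at this
    have h10 : Module.finrank ℂ N = 10 := finrank_cubics
    omega
  let φ : (ℂ × (Fin 3 → ℂ)) →ₗ[ℂ] N :=
    { toFun := fun x => ⟨x.1 • D + K * linForm x.2,
        N.add_mem (N.smul_mem _ hD) (hK.mul (isHomogeneous_linForm _))⟩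
      map_add' := fun x y => by
        ext1
        simp only [linForm, Prod.fst_add, Prod.snd_add, Pi.add_apply, add_smul,
          Finset.sum_add_distrib, Submodule.coe_add]
        ring
      map_smul' := fun c x => by
        ext1
        simp only [linForm, Prod.smul_fst, Prod.smul_snd, Pi.smul_apply, smul_assoc,
          ← Finset.smul_sum, Submodule.coe_smul, RingHom.id_apply, smul_add, mul_smul_comm] }
  have hφ : Function.Injective φ := by
    rw [injective_iff_map_eq_zero]
    rintro ⟨c, w⟩ h
    have h : c • D + K * linForm w = 0 := congrArg Subtype.val h
    have hc : c = 0 := by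
      by_contra hc
      refine hKD ⟨-(c⁻¹ • linForm w), ?_⟩
      have : D = c⁻¹ • (c • D) := by rw [smul_smul, inv_mul_cancel₀ hc, one_smul]
      rw [this, eq_neg_of_add_eq_zero_left h, mul_neg, mul_smul_comm, smul_neg]
    rw [hc, zero_smul, zero_add, mul_eq_zero, or_iff_right hK0, linForm_eq_zero] at h
    rw [hc, h, Prod.mk_zero_zero]
  have hle : LinearMap.range φ ≤ LinearMap.ker ev := by
    rintro _ ⟨x, rfl⟩
    rw [LinearMap.mem_ker]
    ext i
    have h1 := honD i
    have h2 := honK i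
    rw [VanishesAt] at h1 h2
    rw [hev]
    simp [φ, smul_eval, h1, h2]
  have heq : LinearMap.range φ = LinearMap.ker ev := by
    refine Submodule.eq_of_le_of_finrank_le hle ?_
    rw [hker, LinearMap.finrank_range_of_inj hφ]
    simp
  have hmem : (⟨T, hT⟩ : N) ∈ LinearMap.ker ev := by
    rw [LinearMap.mem_ker]
    ext i
    rw [hev]
    exact honT i
  rw [← heq] at hmem
  obtain ⟨⟨τ, w⟩, h⟩ := hmem
  have h : τ • D + K * linForm w = T := congrArg Subtype.val h
  exact ⟨τ, w, by rw [← h]; ring⟩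

/-- The cofactor of a homogeneous divisor of degree 2 in a cubic is a linear form. -/
lemma exists_linForm_of_dvd {K D : Poly3} (hK : K.IsHomogeneous 2) (hD : D.IsHomogeneous 3)
    (h : K ∣ D) : ∃ w, D = K * linForm w := by
  let := gradedAlgebra (σ := Fin 3) (R := ℂ)
  obtain ⟨M, rfl⟩ := h
  have h1 := DirectSum.coe_decompose_mul_add_of_left_mem
    (homogeneousSubmodule (Fin 3) ℂ) (i := 2) (j := 1) (b := M) hK
  rw [DirectSum.decompose_of_mem_same (homogeneousSubmodule (Fin 3) ℂ) (i := 2 + 1) hD] at h1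
  obtain ⟨w, hw⟩ := exists_eq_linForm
    (DirectSum.decompose (homogeneousSubmodule (Fin 3) ℂ) M 1).2
  exact ⟨w, h1.trans (by rw [hw])⟩

lemma IsLineThrough.exists_eq_smul_chord_ne_zero {L : Poly3} {p q : ProjPlane} (h : p ≠ q)
    (hL : IsLineThrough L p q) : ∃ c : ℂ, c ≠ 0 ∧ L = c • chord p q := by
  obtain ⟨hL0, hL1, hp, hq⟩ := hL
  obtain ⟨c, rfl⟩ := exists_eq_smul_chord h hL1 hp hq
  exact ⟨c, fun hc => hL0 (by rw [hc, zero_smul]), rfl⟩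

lemma IsGenPascalLine.of_lines {pt : Fin 6 → ProjPlane} (hpt : Function.Injective pt)
    {f : Fin 6 → Fin 6} (hf : Function.Injective f) {D L l₁ l₂ l₃ : Poly3}
    (h₁ : IsLineThrough l₁ (pt (f 0)) (pt (f 1))) (h₂ : IsLineThrough l₂ (pt (f 2)) (pt (f 3)))
    (h₃ : IsLineThrough l₃ (pt (f 4)) (pt (f 5)))
    (h : IsGenPascalLine (pt 0) (pt 1) (pt 2) (pt 3) (pt 4) (pt 5) D (l₁ * l₂ * l₃) L) :
    IsGenPascalLine (pt 0) (pt 1) (pt 2) (pt 3) (pt 4) (pt 5) D (chordTriple pt f) L := by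
  have hne (i j : Fin 6) (hij : i ≠ j) : pt (f i) ≠ pt (f j) := hpt.ne (hf.ne hij)
  obtain ⟨c₁, hc₁, rfl⟩ := h₁.exists_eq_smul_chord_ne_zero (hne 0 1 (by decide))
  obtain ⟨c₂, hc₂, rfl⟩ := h₂.exists_eq_smul_chord_ne_zero (hne 2 3 (by decide))
  obtain ⟨c₃, hc₃, rfl⟩ := h₃.exists_eq_smul_chord_ne_zero (hne 4 5 (by decide))
  obtain ⟨hrel, hL0, hL, P, Q, R, hd, hz, hPQR⟩ := h
  have hT : c₁ • chord (pt (f 0)) (pt (f 1)) * c₂ • chord (pt (f 2)) (pt (f 3)) *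
      c₃ • chord (pt (f 4)) (pt (f 5)) = (c₁ * c₂ * c₃) • chordTriple pt f := by
    simp only [chordTriple, smul_eq_C_mul, map_mul]
    ring
  rw [hT] at hrel hz
  have hc : c₁ * c₂ * c₃ ≠ 0 := mul_ne_zero (mul_ne_zero hc₁ hc₂) hc₃
  refine ⟨?_, hL0, hL, P, Q, R, hd, ?_, hPQR⟩
  · intro x hx hx'
    exact hrel hx (hx'.trans ⟨C (c₁ * c₂ * c₃), by rw [smul_eq_C_mul, mul_comm]⟩)
  · rw [← hz]
    ext p
    simp [zeroSet, VanishesAt, smul_eval, hc₁, hc₂, hc₃]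

/-- An irreducible conic meets the chord of two of its points only in these points. -/
lemma not_vanishesAt_of_chord {pt : Fin 6 → ProjPlane} (hpt : Function.Injective pt)
    (hn3 : NoThreeCollinear (Set.range pt)) {K : Poly3} (hK : K.IsHomogeneous 2)
    (hKirr : Irreducible K) (honK : ∀ i, VanishesAt K (pt i)) {i j : Fin 6} (hij : i ≠ j)
    {P : ProjPlane} (hP : ∀ i, pt i ≠ P) (h : VanishesAt (chord (pt i) (pt j)) P) :
    ¬ VanishesAt K P := by
  intro hKP
  obtain ⟨q, rfl⟩ := chord_dvd_of_three hK (hpt.ne hij) (hP i) (hP j) (honK i) (honK j) hKP h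
  obtain ⟨k, hik, hjk⟩ : ∃ k, i ≠ k ∧ j ≠ k := by
    clear * -
    decide +revert
  have hk := honK k
  rw [VanishesAt, map_mul] at hk
  have hq0 := (mul_eq_zero.1 hk).resolve_left (chord_not_vanishesAt hpt hn3 hij hik hjk)
  have hq : ¬ IsUnit q := fun hu => (hu.map (eval (pt k).rep)).ne_zero hq0
  have hl : ¬ IsUnit (chord (pt i) (pt j)) := fun hu =>
    (hu.map (eval (pt i).rep)).ne_zero (chord_left (pt i) (pt j))
  exact (hKirr.isUnit_or_isUnit rfl).elim hl hq

/-- A linear form `ℓ` for which `K * ℓ` lies in the pencil of the two cubics is a multiple of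
their generalized Pascal line. -/
lemma IsGenPascalLine.eq_smul {pt : Fin 6 → ProjPlane} (hpt : Function.Injective pt)
    (hn3 : NoThreeCollinear (Set.range pt)) {K : Poly3} (hK : K.IsHomogeneous 2)
    (hKirr : Irreducible K) (honK : ∀ i, VanishesAt K (pt i))
    {f : Fin 6 → Fin 6} (hf : Function.Injective f) {D L : Poly3}
    (h : IsGenPascalLine (pt 0) (pt 1) (pt 2) (pt 3) (pt 4) (pt 5) D (chordTriple pt f) L)
    {w : Fin 3 → ℂ} {α β : ℂ} (hw : K * linForm w = α • chordTriple pt f + β • D) :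
    ∃ c : ℂ, linForm w = c • L := by
  obtain ⟨-, hL0, hL, P, Q, R, hd, hz, hLP, hLQ, -⟩ := h
  simp only [List.pairwise_cons, List.mem_cons, forall_eq_or_imp] at hd
  have hPQ : P ≠ Q := by tauto
  have key (X : ProjPlane) (hX : ∀ i, pt i ≠ X)
      (hmem : X ∈ zeroSet D ∩ zeroSet (chordTriple pt f)) : VanishesAt (linForm w) X := by
    obtain ⟨hDX, hTX⟩ := hmem
    have hKX : ¬ VanishesAt K X := by
      have hTX' := hTX
      simp only [zeroSet, Set.mem_ofPred_eq, VanishesAt, chordTriple, map_mul,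
        mul_eq_zero] at hTX'
      obtain (h | h) | h := hTX'
      all_goals
        exact not_vanishesAt_of_chord hpt hn3 hK hKirr honK (hf.ne (by decide)) hX h
    have := congrArg (eval X.rep) hw
    simp only [zeroSet, Set.mem_ofPred_eq, VanishesAt] at hDX hTX
    simp only [map_mul, map_add, smul_eval, hDX, hTX, mul_zero, add_zero, mul_eq_zero] at this
    exact this.resolve_left hKX
  have hwP := key P (by intro i; fin_cases i <;> simp <;> tauto) (by rw [hz]; simp)
  have hwQ := key Q (by intro i; fin_cases i <;> simp <;> tauto) (by rw [hz]; simp)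
  obtain ⟨a, ha⟩ := exists_eq_smul_chord hPQ (isHomogeneous_linForm w) hwP hwQ
  obtain ⟨b, hb0, hb⟩ := IsLineThrough.exists_eq_smul_chord_ne_zero hPQ ⟨hL0, hL, hLP, hLQ⟩
  exact ⟨a * b⁻¹, by rw [ha, hb, smul_smul, inv_mul_cancel_right₀ hb0]⟩

/-- After rescaling, a generalized Pascal line is the cofactor of the conic in the pencil. -/
lemma IsGenPascalLine.exists_conic_mul {pt : Fin 6 → ProjPlane} (hpt : Function.Injective pt)
    (hn3 : NoThreeCollinear (Set.range pt)) {K : Poly3} (hK : K.IsHomogeneous 2)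
    (hKirr : Irreducible K) (honK : ∀ i, VanishesAt K (pt i))
    {f : Fin 6 → Fin 6} (hf : Function.Injective f) {D L : Poly3} (hKD : ¬ K ∣ D)
    (hD : D.IsHomogeneous 3) (honD : ∀ i, VanishesAt D (pt i))
    (h : IsGenPascalLine (pt 0) (pt 1) (pt 2) (pt 3) (pt 4) (pt 5) D (chordTriple pt f) L) :
    ∃ c τ : ℂ, c ≠ 0 ∧ K * (c • L) = chordTriple pt f - τ • D := by
  have honT (i : Fin 6) : VanishesAt (chordTriple pt f) (pt i) := by
    obtain ⟨k, rfl⟩ := Finite.surjective_of_injective hf i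
    have l (a b : Fin 6) := chord_left (pt (f a)) (pt (f b))
    have r (a b : Fin 6) := chord_right (pt (f a)) (pt (f b))
    simp only [VanishesAt] at l r
    fin_cases k <;> simp [VanishesAt, chordTriple, l, r]
  obtain ⟨τ, w, hw⟩ := exists_conic_mul_eq hpt hn3 hKirr.ne_zero hK honK hKD hD honD
    (isHomogeneous_chordTriple pt f) honT
  obtain ⟨c, hc⟩ := h.eq_smul hpt hn3 hK hKirr honK hf (α := 1) (β := -τ)
    (by rw [hw, one_smul, neg_smul, sub_eq_add_neg])
  refine ⟨c, τ, ?_, by rw [← hc, hw]⟩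
  rintro rfl
  rw [hc, zero_smul, mul_zero] at hw
  have hu : IsUnit D := h.1 dvd_rfl ⟨C τ, by rw [sub_eq_zero.1 hw.symm, smul_eq_C_mul, mul_comm]⟩
  exact (hu.map (eval (pt 0).rep)).ne_zero (honD 0)

/-- If the conic divides the cubic, then all generalized Pascal lines coincide. -/
lemma IsGenPascalLine.proportionalTo_of_dvd {pt : Fin 6 → ProjPlane} (hpt : Function.Injective pt)
    (hn3 : NoThreeCollinear (Set.range pt)) {K : Poly3} (hK : K.IsHomogeneous 2)
    (hKirr : Irreducible K) (honK : ∀ i, VanishesAt K (pt i))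
    {f g : Fin 6 → Fin 6} (hf : Function.Injective f) (hg : Function.Injective g)
    {D L M : Poly3} (hKD : K ∣ D) (hD0 : D ≠ 0) (hD : D.IsHomogeneous 3)
    (hL : IsGenPascalLine (pt 0) (pt 1) (pt 2) (pt 3) (pt 4) (pt 5) D (chordTriple pt f) L)
    (hM : IsGenPascalLine (pt 0) (pt 1) (pt 2) (pt 3) (pt 4) (pt 5) D
      (chordTriple pt g) M) :
    ProportionalTo L M := by
  obtain ⟨w, hw⟩ := exists_linForm_of_dvd hK hD hKD
  have hw0 : linForm w ≠ 0 := fun h => hD0 (by rw [hw, h, mul_zero])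
  obtain ⟨a, ha⟩ := hL.eq_smul hpt hn3 hK hKirr honK hf (α := 0) (β := 1) (w := w)
    (by rw [← hw, zero_smul, one_smul, zero_add])
  obtain ⟨b, hb⟩ := hM.eq_smul hpt hn3 hK hKirr honK hg (α := 0) (β := 1) (w := w)
    (by rw [← hw, zero_smul, one_smul, zero_add])
  have ha0 : a ≠ 0 := fun h => hw0 (by rw [ha, h, zero_smul])
  have hb0 : b ≠ 0 := fun h => hw0 (by rw [hb, h, zero_smul])
  refine ⟨b⁻¹ * a, mul_ne_zero (inv_ne_zero hb0) ha0, ?_⟩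
  rw [mul_smul, ← ha, hb, smul_smul, inv_mul_cancel₀ hb0, one_smul]

/-- The Grassmann–Plücker relation for the pencil of lines through a variable point. -/
lemma chord_pluecker (a b c d : ProjPlane) :
    chord a b * chord c d - chord a c * chord b d + chord a d * chord b c = 0 := by
  simp only [chord, linForm, cross_apply, Fin.sum_univ_three, smul_eq_C_mul]
  simp
  ring

/-- **The generalized Steiner line.** The four generalized `𝒟`-Steiner points
`p₁ ∩ q₁`, `p₂ ∩ q₂`, `p₃ ∩ q₃`, `p₄ ∩ q₄` are collinear. -/
theorem generalized_steiner_line (A B C D E F : ProjPlane)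
    (hdist : ([A, B, C, D, E, F] : List ProjPlane).Pairwise (· ≠ ·))
    (K : Poly3) (hKh : K.IsHomogeneous 2) (hKirr : Irreducible K)
    (honK : ∀ p ∈ [A, B, C, D, E, F], VanishesAt K p)
    (hn3 : NoThreeCollinear {A, B, C, D, E, F})
    (𝒟 : Poly3) (h𝒟0 : 𝒟 ≠ 0) (h𝒟h : 𝒟.IsHomogeneous 3)
    (hon𝒟 : ∀ p ∈ [A, B, C, D, E, F], VanishesAt 𝒟 p)
    (lAB lAC lAD lAE lDF lCE lBC lEF lBD lCF lBF lDE : Poly3)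
    (hlAB : IsLineThrough lAB A B) (hlAC : IsLineThrough lAC A C)
    (hlAD : IsLineThrough lAD A D) (hlAE : IsLineThrough lAE A E)
    (hlDF : IsLineThrough lDF D F) (hlCE : IsLineThrough lCE C E)
    (hlBC : IsLineThrough lBC B C) (hlEF : IsLineThrough lEF E F)
    (hlBD : IsLineThrough lBD B D) (hlCF : IsLineThrough lCF C F)
    (hlBF : IsLineThrough lBF B F) (hlDE : IsLineThrough lDE D E)
    (p₁ p₂ p₃ p₄ q₁ q₂ q₃ q₄ : Poly3)
    (hp₁ : IsGenPascalLine A B C D E F 𝒟 (lAB * lDF * lCE) p₁)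
    (hp₂ : IsGenPascalLine A B C D E F 𝒟 (lAD * lBC * lEF) p₂)
    (hp₃ : IsGenPascalLine A B C D E F 𝒟 (lAE * lBD * lCF) p₃)
    (hp₄ : IsGenPascalLine A B C D E F 𝒟 (lAC * lBF * lDE) p₄)
    (hq₁ : IsGenPascalLine A B C D E F 𝒟 (lAC * lEF * lBD) q₁)
    (hq₂ : IsGenPascalLine A B C D E F 𝒟 (lAB * lCF * lDE) q₂)
    (hq₃ : IsGenPascalLine A B C D E F 𝒟 (lAD * lBF * lCE) q₃)
    (hq₄ : IsGenPascalLine A B C D E F 𝒟 (lAE * lBC * lDF) q₄)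
    (hne : ∀ i : Fin 4, ¬ ProportionalTo (![p₁, p₂, p₃, p₄] i) (![q₁, q₂, q₃, q₄] i))
    (S₁ S₂ S₃ S₄ : ProjPlane)
    (hS : ∀ i : Fin 4, VanishesAt (![p₁, p₂, p₃, p₄] i) (![S₁, S₂, S₃, S₄] i) ∧
      VanishesAt (![q₁, q₂, q₃, q₄] i) (![S₁, S₂, S₃, S₄] i)) :
    Collin {S₁, S₂, S₃, S₄} := by
  set pt : Fin 6 → ProjPlane := ![A, B, C, D, E, F] with hptdef
  have hpt : Function.Injective pt := by
    simp only [List.pairwise_cons, List.mem_cons, forall_eq_or_imp] at hdist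
    intro i j hij
    fin_cases i <;> fin_cases j <;> simp [hptdef] at hij ⊢ <;> grind
  have hrange : Set.range pt = {A, B, C, D, E, F} := by
    ext p
    simp [hptdef, eq_comm]
    tauto
  rw [← hrange] at hn3
  have honK' (i : Fin 6) : VanishesAt K (pt i) := honK _ (by fin_cases i <;> simp [hptdef])
  have hon𝒟' (i : Fin 6) : VanishesAt 𝒟 (pt i) := hon𝒟 _ (by fin_cases i <;> simp [hptdef])
  have ip₁ : Function.Injective (![0, 1, 3, 5, 2, 4] : Fin 6 → Fin 6) := by decide
  have ip₂ : Function.Injective (![0, 3, 1, 2, 4, 5] : Fin 6 → Fin 6) := by decide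
  have ip₃ : Function.Injective (![0, 4, 1, 3, 2, 5] : Fin 6 → Fin 6) := by decide
  have ip₄ : Function.Injective (![0, 2, 1, 5, 3, 4] : Fin 6 → Fin 6) := by decide
  have iq₁ : Function.Injective (![0, 2, 4, 5, 1, 3] : Fin 6 → Fin 6) := by decide
  have iq₂ : Function.Injective (![0, 1, 2, 5, 3, 4] : Fin 6 → Fin 6) := by decide
  have iq₃ : Function.Injective (![0, 3, 1, 5, 2, 4] : Fin 6 → Fin 6) := by decide
  have iq₄ : Function.Injective (![0, 4, 1, 2, 3, 5] : Fin 6 → Fin 6) := by decide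
  have tp₁ := IsGenPascalLine.of_lines hpt ip₁ hlAB hlDF hlCE hp₁
  have tp₂ := IsGenPascalLine.of_lines hpt ip₂ hlAD hlBC hlEF hp₂
  have tp₃ := IsGenPascalLine.of_lines hpt ip₃ hlAE hlBD hlCF hp₃
  have tp₄ := IsGenPascalLine.of_lines hpt ip₄ hlAC hlBF hlDE hp₄
  have tq₁ := IsGenPascalLine.of_lines hpt iq₁ hlAC hlEF hlBD hq₁
  have tq₂ := IsGenPascalLine.of_lines hpt iq₂ hlAB hlCF hlDE hq₂
  have tq₃ := IsGenPascalLine.of_lines hpt iq₃ hlAD hlBF hlCE hq₃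
  have tq₄ := IsGenPascalLine.of_lines hpt iq₄ hlAE hlBC hlDF hq₄
  have hKD : ¬ K ∣ 𝒟 := fun hKD =>
    hne 0 (tp₁.proportionalTo_of_dvd hpt hn3 hKh hKirr honK' ip₁ iq₁ hKD h𝒟0 h𝒟h tq₁)
  obtain ⟨a₁, σ₁, ha₁, ep₁⟩ := tp₁.exists_conic_mul hpt hn3 hKh hKirr honK' ip₁ hKD h𝒟h hon𝒟'
  obtain ⟨a₂, σ₂, ha₂, ep₂⟩ := tp₂.exists_conic_mul hpt hn3 hKh hKirr honK' ip₂ hKD h𝒟h hon𝒟'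
  obtain ⟨a₃, σ₃, ha₃, ep₃⟩ := tp₃.exists_conic_mul hpt hn3 hKh hKirr honK' ip₃ hKD h𝒟h hon𝒟'
  obtain ⟨a₄, σ₄, ha₄, ep₄⟩ := tp₄.exists_conic_mul hpt hn3 hKh hKirr honK' ip₄ hKD h𝒟h hon𝒟'
  obtain ⟨b₁, τ₁, hb₁, eq₁⟩ := tq₁.exists_conic_mul hpt hn3 hKh hKirr honK' iq₁ hKD h𝒟h hon𝒟'
  obtain ⟨b₂, τ₂, hb₂, eq₂⟩ := tq₂.exists_conic_mul hpt hn3 hKh hKirr honK' iq₂ hKD h𝒟h hon𝒟'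
  obtain ⟨b₃, τ₃, hb₃, eq₃⟩ := tq₃.exists_conic_mul hpt hn3 hKh hKirr honK' iq₃ hKD h𝒟h hon𝒟'
  obtain ⟨b₄, τ₄, hb₄, eq₄⟩ := tq₄.exists_conic_mul hpt hn3 hKh hKirr honK' iq₄ hKD h𝒟h hon𝒟'
  simp only [chordTriple, Matrix.cons_val, hptdef] at ep₁ ep₂ ep₃ ep₄ eq₁ eq₂ eq₃ eq₄
  have hsame (M : Poly3) (τ : ℂ) (hM : K * (a₁ • p₁ - b₁ • q₁ - M) = τ • 𝒟) :
      M = a₁ • p₁ - b₁ • q₁ := by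
    have hτ : τ = 0 := by
      by_contra hτ
      refine hKD ⟨τ⁻¹ • (a₁ • p₁ - b₁ • q₁ - M), ?_⟩
      rw [mul_smul_comm, hM, smul_smul, inv_mul_cancel₀ hτ, one_smul]
    rw [hτ, zero_smul, mul_eq_zero, or_iff_right hKirr.ne_zero, sub_eq_zero] at hM
    exact hM.symm
  have hm₂ := hsame (b₂ • q₂ - a₂ • p₂) ((τ₁ - σ₁) - (σ₂ - τ₂)) (by
    simp only [smul_eq_C_mul, map_sub] at *
    linear_combination ep₁ - eq₁ - eq₂ + ep₂ - chord A B * chord_pluecker C D E F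
      + chord E F * chord_pluecker A B C D)
  have hm₃ := hsame (b₃ • q₃ - a₃ • p₃) ((τ₁ - σ₁) - (σ₃ - τ₃)) (by
    simp only [smul_eq_C_mul, map_sub] at *
    linear_combination ep₁ - eq₁ - eq₃ + ep₃ + chord C E * chord_pluecker A B D F
      - chord B D * chord_pluecker A C E F)
  have hm₄ := hsame (a₄ • p₄ - b₄ • q₄) ((τ₁ - σ₁) - (τ₄ - σ₄)) (by
    simp only [smul_eq_C_mul, map_sub] at *
    linear_combination ep₁ - eq₁ - ep₄ + eq₄ + chord D F * chord_pluecker A B C E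
      - chord A C * chord_pluecker B D E F)
  have hvan (p q : Poly3) (a b : ℂ) (S : ProjPlane) (hp : VanishesAt p S) (hq : VanishesAt q S) :
      VanishesAt (a • p - b • q) S := by
    simp only [VanishesAt] at *
    simp [smul_eval, hp, hq]
  refine ⟨a₁ • p₁ - b₁ • q₁, ?_, ?_, ?_⟩
  · intro h0
    refine hne 0 ⟨b₁⁻¹ * a₁, mul_ne_zero (inv_ne_zero hb₁) ha₁, ?_⟩
    change q₁ = (b₁⁻¹ * a₁) • p₁
    rw [mul_smul, sub_eq_zero.1 h0, smul_smul, inv_mul_cancel₀ hb₁, one_smul]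
  · exact (homogeneousSubmodule (Fin 3) ℂ 1).sub_mem
      ((homogeneousSubmodule (Fin 3) ℂ 1).smul_mem _ hp₁.2.2.1)
      ((homogeneousSubmodule (Fin 3) ℂ 1).smul_mem _ hq₁.2.2.1)
  · rintro p (rfl | rfl | rfl | rfl)
    · exact hvan _ _ _ _ _ (hS 0).1 (hS 0).2
    · rw [← hm₂]
      exact hvan _ _ _ _ _ (hS 1).2 (hS 1).1
    · rw [← hm₃]
      exact hvan _ _ _ _ _ (hS 2).2 (hS 2).1
    · rw [← hm₄]
      exact hvan _ _ _ _ _ (hS 3).1 (hS 3).2
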